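/- arXiv:2209.10309 — 2 statements merged into one kernel-verified Lean document; each statement's English description precedes it below -/
import Mathlib

section
/- For every sentence φ of dFO²[Σ]: there exists a 2-data structure 𝔄 over Σ with 𝔄 ⊨ φ if and only if there exist a 3-data structure 𝔅 over Σ and an element a of 𝔅 such that the 2-view 𝔅|_a^2 satisfies φ, where φ is read as a dFO³[Σ] formula not mentioning the third data values (i.e., 𝔅 satisfies ∃x.⟨φ⟩_x^2). -/
/-- One step in the data graph of a `D`-data structure with data functions `f`:
`(a,i)` and `(b,j)` are related iff `a = b` or `f i a = f j b`. -/
def dataEdge {A : Type} {D : ℕ} (f : Fin D → A → ℕ) (v w : A × Fin D) : Prop :=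
  v.1 = w.1 ∨ f v.2 v.1 = f w.2 w.1

/-- `distLE f r v w` holds iff the distance between `v` and `w` in the data graph
is at most `r` (the edge relation is reflexive, so walks may stutter). -/
def distLE {A : Type} {D : ℕ} (f : Fin D → A → ℕ) : ℕ → A × Fin D → A × Fin D → Prop
  | 0 => fun v w => v = w
  | r + 1 => fun v w => ∃ u, distLE f r v u ∧ dataEdge f u w

/-- `(b,j) ∈ B_r(a)` : membership in the radius-`r` ball around `a`. -/
def inBall {A : Type} {D : ℕ} (f : Fin D → A → ℕ) (r : ℕ) (a : A) (v : A × Fin D) : Prop :=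
  ∃ i : Fin D, distLE f r (a, i) v

/-- `Values(𝔄)` : the set of data values occurring in the structure. -/
def dataValues {A : Type} {D : ℕ} (f : Fin D → A → ℕ) : Set ℕ :=
  {v | ∃ (b : A) (i : Fin D), f i b = v}

/-- `IsView f r a fnew f'` : `f'` is the family of data functions of the `r`-view
`𝔄|_a^r`, built from the injection `fnew` into fresh values. -/
def IsView {A : Type} {D : ℕ} (f : Fin D → A → ℕ) (r : ℕ) (a : A)
    (fnew : A × Fin D → ℕ) (f' : Fin D → A → ℕ) : Prop :=
  ∀ (b : A) (i : Fin D),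
    (inBall f r a (b, i) → f' i b = f i b) ∧
    (¬ inBall f r a (b, i) → f' i b = fnew (b, i))

/-- Formulas of `dFO^D[Σ]`: unary predicates, data relations `x ∼_{i,j} y`,
equality, disjunction, negation and existential quantification.
Variables are represented by natural numbers. -/
inductive DFO (Sg : Type) (D : ℕ) : Type
  | pred : Sg → ℕ → DFO Sg D
  | rel : Fin D → Fin D → ℕ → ℕ → DFO Sg D
  | eq : ℕ → ℕ → DFO Sg D
  | or : DFO Sg D → DFO Sg D → DFO Sg D
  | not : DFO Sg D → DFO Sg D
  | ex : ℕ → DFO Sg D → DFO Sg D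

/-- Satisfaction `𝔄 ⊨_I φ` over the `D`-data structure with universe `A`,
predicates `P` and data functions `f`. -/
def DFO.Sat {Sg : Type} {D : ℕ} {A : Type} (P : Sg → Set A) (f : Fin D → A → ℕ) :
    DFO Sg D → (ℕ → A) → Prop
  | .pred σ x, I => I x ∈ P σ
  | .rel i j x y, I => f i (I x) = f j (I y)
  | .eq x y, I => I x = I y
  | .or φ ψ, I => DFO.Sat P f φ I ∨ DFO.Sat P f ψ I
  | .not φ, I => ¬ DFO.Sat P f φ I
  | .ex x φ, I => ∃ a : A, DFO.Sat P f φ (Function.update I x a)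

/-- `𝔄 ⊨ φ` : satisfaction under some interpretation function. -/
def DFO.Models {Sg : Type} {D : ℕ} {A : Type} (P : Sg → Set A)
    (f : Fin D → A → ℕ) (φ : DFO Sg D) : Prop :=
  ∃ I : ℕ → A, DFO.Sat P f φ I

/-- Free variables of a formula. -/
def DFO.free {Sg : Type} {D : ℕ} : DFO Sg D → Finset ℕ
  | .pred _ x => {x}
  | .rel _ _ x y => {x, y}
  | .eq x y => {x, y}
  | .or φ ψ => φ.free ∪ ψ.free
  | .not φ => φ.free
  | .ex x φ => φ.free.erase x

/-- Conjunction, as the usual abbreviation. -/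
def DFO.and {Sg : Type} {D : ℕ} (φ ψ : DFO Sg D) : DFO Sg D :=
  .not (.or (.not φ) (.not ψ))

/-- Reading a `dFO^D[Σ]` formula as a `dFO^{D'}[Σ]` formula (`D ≤ D'`): the
formula simply never mentions the extra data values. -/
def DFO.castLE {Sg : Type} {D D' : ℕ} (h : D ≤ D') : DFO Sg D → DFO Sg D'
  | .pred σ x => .pred σ x
  | .rel i j x y => .rel (Fin.castLE h i) (Fin.castLE h j) x y
  | .eq x y => .eq x y
  | .or φ ψ => .or (φ.castLE h) (ψ.castLE h)
  | .not φ => .not (φ.castLE h)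
  | .ex x φ => .ex x (φ.castLE h)

/-- Satisfaction of a formula read with extra data values only depends on the
data functions that it mentions. -/
theorem DFO.sat_castLE {Sg : Type} {D D' : ℕ} (h : D ≤ D') {A : Type} (P : Sg → Set A)
    (g : Fin D' → A → ℕ) (φ : DFO Sg D) (I : ℕ → A) :
    DFO.Sat P g (φ.castLE h) I ↔ DFO.Sat P (fun i => g (Fin.castLE h i)) φ I := by
  induction φ generalizing I with
  | pred | rel | eq => rfl
  | or φ ψ ihφ ihψ => exact or_congr (ihφ I) (ihψ I)
  | not φ ih => exact not_congr (ih I)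
  | ex x φ ih => exact exists_congr fun a => ih _

/-- An element sharing a data value with `a` has all its data values in the radius-2 ball. -/
theorem inBall_two_of_eq {A : Type} {D : ℕ} {f : Fin D → A → ℕ} {a b : A} {i j : Fin D}
    (h : f i a = f j b) (k : Fin D) : inBall f 2 a (b, k) :=
  ⟨i, (b, j), ⟨(a, i), rfl, Or.inr h⟩, Or.inl rfl⟩

/-- Over a finite universe there is an injection into values fresh for the structure. -/
theorem exists_injective_fresh {A : Type} [Finite A] {D : ℕ} (f : Fin D → A → ℕ) :
    ∃ fnew : A × Fin D → ℕ, Function.Injective fnew ∧ ∀ v, fnew v ∉ dataValues f := by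
  obtain ⟨e, he⟩ := exists_injective_nat (A × Fin D)
  obtain ⟨m, hm⟩ := (Set.finite_range fun v : A × Fin D => f v.2 v.1).bddAbove
  refine ⟨fun v => m + 1 + e v, fun v w hvw => he (Nat.add_left_cancel hvw), ?_⟩
  rintro v ⟨b, i, hb⟩
  have hle : f i b ≤ m := hm ⟨(b, i), rfl⟩
  dsimp only at hb
  omega

/-- The view at `a` exists for every choice of fresh values. -/
theorem exists_isView {A : Type} {D : ℕ} (f : Fin D → A → ℕ) (r : ℕ) (a : A)
    (fnew : A × Fin D → ℕ) : ∃ f', IsView f r a fnew f' := by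
  classical
  exact ⟨fun i b => if inBall f r a (b, i) then f i b else fnew (b, i),
    fun b i => ⟨fun h => if_pos h, fun h => if_neg h⟩⟩

/-- a sentence `φ` of `dFO²[Σ]` is satisfiable over 2-data
structures iff some 3-data structure `𝔅` over `Σ` has an element `a` whose
2-view satisfies `φ` (read as a `dFO³[Σ]` formula not mentioning the third
data values), i.e. iff `∃x.⟨φ⟩_x^2` is satisfiable over 3-data structures. -/
theorem two_data_to_three_data_radius_two {Sg : Type} (φ : DFO Sg 2)
    (hφ : φ.free = ∅) :
    (∃ (A : Type) (_ : Finite A) (_ : Nonempty A)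
        (P : Sg → Set A) (f : Fin 2 → A → ℕ), DFO.Models P f φ) ↔
    (∃ (B : Type) (_ : Finite B) (_ : Nonempty B)
        (Q : Sg → Set B) (g : Fin 3 → B → ℕ) (a : B),
      ∀ fnew : B × Fin 3 → ℕ, Function.Injective fnew →
        (∀ v, fnew v ∉ dataValues g) →
        ∀ g' : Fin 3 → B → ℕ, IsView g 2 a fnew g' →
          DFO.Models Q g' (φ.castLE (by omega))) := by
  constructor
  · rintro ⟨A, hfin, hne, P, f, I, hI⟩
    refine ⟨A, hfin, hne, P, Fin.snoc f fun _ => 0, hne.some, ?_⟩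
    intro fnew _ _ g' hg'
    refine ⟨I, (DFO.sat_castLE _ P g' φ I).2 ?_⟩
    have hf : (fun i => g' (Fin.castLE (by omega) i)) = f := by
      funext i b
      refine ((hg' b i.castSucc).1 (inBall_two_of_eq (i := Fin.last 2) (j := Fin.last 2) ?_ _)).trans
        ?_
      · simp only [Fin.snoc_last]
      · simp only [Fin.snoc_castSucc]
    rwa [hf]
  · rintro ⟨B, hfin, hne, Q, g, a, h⟩
    obtain ⟨fnew, hinj, hfresh⟩ := exists_injective_fresh g
    obtain ⟨g', hg'⟩ := exists_isView g 2 a fnew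
    obtain ⟨I, hI⟩ := h fnew hinj hfresh g' hg'
    exact ⟨B, hfin, hne, Q, _, I, (DFO.sat_castLE _ Q g' φ I).1 hI⟩
end

section
/- Let 𝔄 = (A,(P_σ),f_1,f_2) be a 2-data structure over Σ, ā = (a_1,…,a_n) ∈ A^n, p ≤ n, and j,k ∈ {1,2}. For all b,c ∈ A: the 2-view 𝔄|_{a_p}^2 satisfies b ∼_{j,k} c if and only if the 1-data structure ⟦𝔄⟧_ā satisfies φ^{r=1}_{j,k,p}(b,c) ∨ φ^{r=2}_{j,k,p}(b,c) ∨ φ^{r>2}_{j,k,p}(b,c), where, writing B1^j_p(y) := p[1,j](y) ∨ p[2,j](y) and B2_p(y) := B1^1_p(y) ∨ B1^2_p(y): φ^{r=1}_{j,k,p}(y,z) := B1^j_p(y) ∧ B1^k_p(z) ∧ ⋁_{i=1,2}(p[i,j](y) ∧ p[i,k](z)); φ^{r=2}_{j,k,p}(y,z) := (B2_p(y) ∧ ¬B1^j_p(y)) ∧ (B2_p(z) ∧ ¬B1^k_p(z)) ∧ (y ∼ z ∨ ⋁_{p'≤n}⋁_{ℓ=1,2}(p'[ℓ,j](y) ∧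 p'[ℓ,k](z))); and φ^{r>2}_{j,k,p}(y,z) := ¬B2_p(y) ∧ ¬B2_p(z) ∧ y = z if j = k, and φ^{r>2}_{j,k,p}(y,z) := ⊥ if j ≠ k. Here y ∼ z denotes equality of the data values of y and z in ⟦𝔄⟧_ā, and p[i,j](y) denotes membership of y in the predicate P_{p[i,j]}. -/
/-- `Val(ā)` : the set of data values carried by the designated tuple `ā`. -/
def tupleValues {A : Type} {D : ℕ} {n : ℕ} (f : Fin D → A → ℕ) (as : Fin n → A) : Set ℕ :=
  {v | ∃ (p : Fin n) (i : Fin D), f i (as p) = v}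

/-- `IsAbstraction f as g fabs` : `fabs` is the data function of the 1-data
structure `⟦𝔄⟧_ā` (here `f 0 = f_1`, `f 1 = f_2` and `g` is the fixed injection
into fresh values). -/
def IsAbstraction {A : Type} {n : ℕ} (f : Fin 2 → A → ℕ) (as : Fin n → A)
    (g : A → ℕ) (fabs : A → ℕ) : Prop :=
  ∀ b : A,
    ((f 0 b ∈ tupleValues f as ∧ f 1 b ∉ tupleValues f as) → fabs b = f 1 b) ∧
    ((f 0 b ∉ tupleValues f as ∧ f 1 b ∈ tupleValues f as) → fabs b = f 0 b) ∧
    ((¬ (f 0 b ∈ tupleValues f as ∧ f 1 b ∉ tupleValues f as) ∧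
      ¬ (f 0 b ∉ tupleValues f as ∧ f 1 b ∈ tupleValues f as)) → fabs b = g b)

theorem inBall_two_iff {A : Type} {D : ℕ} (f : Fin D → A → ℕ) (a b : A) (j : Fin D) :
    inBall f 2 a (b, j) ↔ ∃ j' i : Fin D, f i a = f j' b := by
  constructor
  · rintro ⟨i, ⟨c, k⟩, ⟨_, rfl, h⟩, h'⟩
    simp only [dataEdge] at h h'
    rcases h with rfl | h <;> rcases h' with rfl | h'
    · exact ⟨i, i, rfl⟩
    · exact ⟨j, k, h'⟩
    · exact ⟨k, i, h⟩
    · exact ⟨j, i, h.trans h'⟩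
  · rintro ⟨j', i, h⟩
    exact ⟨i, (b, j'), ⟨(a, i), rfl, Or.inr h⟩, Or.inl rfl⟩

theorem IsAbstraction.eq_value {A : Type} {n : ℕ} {f : Fin 2 → A → ℕ} {as : Fin n → A}
    {g fabs : A → ℕ} (h : IsAbstraction f as g fabs) {b : A} {i j : Fin 2}
    (hi : f i b ∈ tupleValues f as) (hj : f j b ∉ tupleValues f as) : fabs b = f j b := by
  obtain ⟨h₁, h₂, -⟩ := h b
  fin_cases i <;> fin_cases j
  · exact absurd hi hj
  · exact h₁ ⟨hi, hj⟩
  · exact h₂ ⟨hj, hi⟩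
  · exact absurd hi hj

theorem IsAbstraction.eq_fresh {A : Type} {n : ℕ} {f : Fin 2 → A → ℕ} {as : Fin n → A}
    {g fabs : A → ℕ} (h : IsAbstraction f as g fabs) {b : A} {i j : Fin 2} (hij : i ≠ j)
    (hi : f i b ∈ tupleValues f as) (hj : f j b ∈ tupleValues f as) : fabs b = g b := by
  obtain ⟨-, -, h₃⟩ := h b
  fin_cases i <;> fin_cases j
  · exact absurd rfl hij
  · exact h₃ ⟨fun h => h.2 hj, fun h => h.1 hi⟩
  · exact h₃ ⟨fun h => h.2 hi, fun h => h.1 hj⟩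
  · exact absurd rfl hij

/-- For elements whose `j`-th (resp. `k`-th) value is not carried by `a_p` while their other value
is, equality of these values is determined by the abstraction and the tuple predicates. -/
theorem IsAbstraction.eq_iff {A : Type} {n : ℕ} {f : Fin 2 → A → ℕ} {as : Fin n → A}
    {g fabs : A → ℕ} (h : IsAbstraction f as g fabs) (hginj : Function.Injective g)
    (hgfresh : ∀ b : A, g b ∉ dataValues f) {p : Fin n} {j k : Fin 2} {b c : A}
    (hb : ∃ j' i : Fin 2, f i (as p) = f j' b) (hbj : ¬ ∃ i : Fin 2, f i (as p) = f j b)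
    (hc : ∃ j' i : Fin 2, f i (as p) = f j' c) (hck : ¬ ∃ i : Fin 2, f i (as p) = f k c) :
    (fabs b = fabs c ∨ ∃ (p' : Fin n) (l : Fin 2), f l (as p') = f j b ∧ f l (as p') = f k c) ↔
      f j b = f k c := by
  obtain ⟨j', hb⟩ := hb
  obtain ⟨k', hc⟩ := hc
  have hj : j' ≠ j := by rintro rfl; exact hbj hb
  have hk : k' ≠ k := by rintro rfl; exact hck hc
  have hbv : f j' b ∈ tupleValues f as := ⟨p, hb⟩
  have hcv : f k' c ∈ tupleValues f as := ⟨p, hc⟩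
  constructor
  · rintro (e | ⟨p', l, h₁, h₂⟩)
    · by_cases h₁ : f j b ∈ tupleValues f as <;> by_cases h₂ : f k c ∈ tupleValues f as
      · rw [h.eq_fresh hj hbv h₁, h.eq_fresh hk hcv h₂] at e
        obtain rfl := hginj e
        have hjk : j = k := by
          by_contra hne
          have hjk' : j' = k := by omega
          exact hck (hjk' ▸ hb)
        rw [hjk]
      · rw [h.eq_fresh hj hbv h₁, h.eq_value hcv h₂] at e
        exact absurd ⟨c, k, e.symm⟩ (hgfresh b)
      · rw [h.eq_value hbv h₁, h.eq_fresh hk hcv h₂] at e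
        exact absurd ⟨b, j, e⟩ (hgfresh c)
      · rwa [h.eq_value hbv h₁, h.eq_value hcv h₂] at e
    · exact h₁.symm.trans h₂
  · intro e
    by_cases h₁ : f j b ∈ tupleValues f as
    · obtain ⟨p', l, hl⟩ := h₁
      exact Or.inr ⟨p', l, hl, hl.trans e⟩
    · left
      rw [h.eq_value hbv h₁, h.eq_value hcv (e ▸ h₁), e]

/-- the 2-view `𝔄|_{a_p}^2` satisfies the atom `b ∼_{j,k} c` iff
the 1-data structure `⟦𝔄⟧_ā` satisfies
`φ^{r=1}_{j,k,p}(b,c) ∨ φ^{r=2}_{j,k,p}(b,c) ∨ φ^{r>2}_{j,k,p}(b,c)`,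
where `p[i,j](y)` unfolds to `f_i(a_p) = f_j(y)`, `B1^j_p(y)` to
`∃ i, f_i(a_p) = f_j(y)`, `B2_p(y)` to `∃ j' i, f_i(a_p) = f_{j'}(y)`, and
`y ∼ z` to equality of the data values in `⟦𝔄⟧_ā`. -/
theorem view_two_atom_translation {A : Type} [Finite A] [Nonempty A]
    {Sg : Type} (P : Sg → Set A) (f : Fin 2 → A → ℕ) {n : ℕ} (as : Fin n → A)
    (g : A → ℕ) (hginj : Function.Injective g)
    (hgfresh : ∀ b : A, g b ∉ dataValues f)
    (fabs : A → ℕ) (habs : IsAbstraction f as g fabs)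
    (p : Fin n) (j k : Fin 2) (b c : A)
    (fnew : A × Fin 2 → ℕ) (hinj : Function.Injective fnew)
    (hfresh : ∀ v, fnew v ∉ dataValues f)
    (f' : Fin 2 → A → ℕ) (hview : IsView f 2 (as p) fnew f') :
    f' j b = f' k c ↔
      -- φ^{r=1}_{j,k,p}(b,c)
      (((∃ i : Fin 2, f i (as p) = f j b) ∧ (∃ i : Fin 2, f i (as p) = f k c) ∧
          ∃ i : Fin 2, f i (as p) = f j b ∧ f i (as p) = f k c) ∨
      -- φ^{r=2}_{j,k,p}(b,c)
        (((∃ (j' i : Fin 2), f i (as p) = f j' b) ∧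
            ¬ (∃ i : Fin 2, f i (as p) = f j b)) ∧
          ((∃ (j' i : Fin 2), f i (as p) = f j' c) ∧
            ¬ (∃ i : Fin 2, f i (as p) = f k c)) ∧
          (fabs b = fabs c ∨
            ∃ (p' : Fin n) (ℓ : Fin 2),
              f ℓ (as p') = f j b ∧ f ℓ (as p') = f k c)) ∨
      -- φ^{r>2}_{j,k,p}(b,c)
        (j = k ∧ ¬ (∃ (j' i : Fin 2), f i (as p) = f j' b) ∧
          ¬ (∃ (j' i : Fin 2), f i (as p) = f j' c) ∧ b = c)) := by
  have hv := hview
  simp only [IsView, inBall_two_iff] at hv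
  by_cases hb : ∃ j' i : Fin 2, f i (as p) = f j' b <;>
    by_cases hc : ∃ j' i : Fin 2, f i (as p) = f j' c
  · rw [(hv b j).1 hb, (hv c k).1 hc]
    constructor
    · intro e
      by_cases hbj : ∃ i : Fin 2, f i (as p) = f j b
      · obtain ⟨i, hi⟩ := hbj
        exact Or.inl ⟨⟨i, hi⟩, ⟨i, hi.trans e⟩, i, hi, hi.trans e⟩
      · have hck : ¬ ∃ i : Fin 2, f i (as p) = f k c := e ▸ hbj
        exact Or.inr (Or.inl ⟨⟨hb, hbj⟩, ⟨hc, hck⟩,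
          (habs.eq_iff hginj hgfresh hb hbj hc hck).2 e⟩)
    · rintro (⟨-, -, i, h₁, h₂⟩ | ⟨⟨-, hbj⟩, ⟨-, hck⟩, h⟩ | ⟨-, h, -⟩)
      · exact h₁.symm.trans h₂
      · exact (habs.eq_iff hginj hgfresh hb hbj hc hck).1 h
      · exact absurd hb h
  · rw [(hv b j).1 hb, (hv c k).2 hc]
    refine iff_of_false (fun e => hfresh (c, k) ⟨b, j, e⟩) ?_
    rintro (⟨-, h, -⟩ | ⟨-, ⟨h, -⟩, -⟩ | ⟨-, h, -⟩)
    · exact hc ⟨k, h⟩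
    · exact hc h
    · exact h hb
  · rw [(hv b j).2 hb, (hv c k).1 hc]
    refine iff_of_false (fun e => hfresh (b, j) ⟨c, k, e.symm⟩) ?_
    rintro (⟨h, -⟩ | ⟨⟨h, -⟩, -⟩ | ⟨-, -, h, -⟩)
    · exact hb ⟨j, h⟩
    · exact hb h
    · exact h hc
  · rw [(hv b j).2 hb, (hv c k).2 hc, hinj.eq_iff, Prod.mk.injEq]
    constructor
    · rintro ⟨h₁, h₂⟩
      exact Or.inr (Or.inr ⟨h₂, hb, hc, h₁⟩)
    · rintro (⟨h, -⟩ | ⟨⟨h, -⟩, -⟩ | ⟨h₂, -, -, h₁⟩)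
      · exact absurd ⟨j, h⟩ hb
      · exact absurd h hb
      · exact ⟨h₁, h₂⟩
end
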